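/- arXiv:1806.06149 — 2 statements merged into one kernel-verified Lean document; each statement's English description precedes it below -/
import Mathlib

section
/- For every integer k > 0 and every finite simple graph G, for every k-list assignment L of G there exists an L-colouring of G in which every vertex v has at most ⌊deg(v)/k⌋ neighbours receiving the same colour as v. -/
open Finset in
theorem Finset.sum_sum_eq_two_mul_add_sum_erase {V : Type*} [Fintype V] [DecidableEq V]
    (f : V → V → ℕ) (hf : ∀ u w, f u w = f w u) (v : V) (hv : f v v = 0) :
    ∑ u, ∑ w, f u w =
      2 * ∑ w, f v w + ∑ u ∈ univ.erase v, ∑ w ∈ univ.erase v, f u w := by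
  have hrow : ∀ u, ∑ w, f u w = f u v + ∑ w ∈ univ.erase v, f u w := fun u =>
    (add_sum_erase univ (f u) (mem_univ v)).symm
  rw [← add_sum_erase univ (fun u => ∑ w, f u w) (mem_univ v),
    sum_congr rfl (fun u _ => hrow u), sum_add_distrib, hrow v, hv,
    sum_congr rfl (fun u _ => hf u v)]
  ring

namespace SimpleGraph

variable {V : Type*} [Fintype V] (G : SimpleGraph V) [DecidableRel G.Adj]

/-- The number of neighbours of `v` that receive the colour `a` under `c`. -/
def colourDegree (c : V → ℕ) (v : V) (a : ℕ) : ℕ :=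
  ((G.neighborFinset v).filter (fun w => c w = a)).card

/-- The number of ordered pairs of adjacent vertices with the same colour under `c`. -/
def monochromaticDarts (c : V → ℕ) : ℕ :=
  ∑ u, ∑ w, if G.Adj u w ∧ c u = c w then 1 else 0

theorem colourDegree_eq_sum (c : V → ℕ) (v : V) :
    G.colourDegree c v (c v) = ∑ w, if G.Adj v w ∧ c v = c w then 1 else 0 := by
  rw [colourDegree, ← Finset.card_filter]
  congr 1
  ext w
  simp [eq_comm]

theorem exists_colourDegree_le_degree_div {k : ℕ} (hk : 0 < k) (c : V → ℕ) (v : V)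
    (s : Finset ℕ) (hs : k ≤ s.card) :
    ∃ a ∈ s, G.colourDegree c v a ≤ G.degree v / k := by
  have hlt : (G.neighborFinset v).card < s.card * (G.degree v / k + 1) :=
    (Nat.lt_mul_div_succ (G.degree v) hk).trans_le (Nat.mul_le_mul_right _ hs)
  obtain ⟨a, ha, h⟩ := Finset.exists_card_fiber_lt_of_card_lt_mul (f := c) hlt
  exact ⟨a, ha, Nat.lt_succ_iff.1 h⟩

variable [DecidableEq V]

open Finset in
theorem monochromaticDarts_update_add (c : V → ℕ) (v : V) (a : ℕ) :
    G.monochromaticDarts (Function.update c v a) + 2 * G.colourDegree c v (c v) =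
      G.monochromaticDarts c + 2 * G.colourDegree c v a := by
  have hsplit : ∀ c : V → ℕ, G.monochromaticDarts c = 2 * G.colourDegree c v (c v) +
      ∑ u ∈ univ.erase v, ∑ w ∈ univ.erase v, if G.Adj u w ∧ c u = c w then 1 else 0 := by
    intro c
    rw [colourDegree_eq_sum]
    exact sum_sum_eq_two_mul_add_sum_erase _
      (fun u w => by simp only [G.adj_comm u w, eq_comm (a := c u)]) v (by simp)
  have hdeg : G.colourDegree (Function.update c v a) v (Function.update c v a v) =
      G.colourDegree c v a := by
    rw [Function.update_self]
    unfold colourDegree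
    congr 1
    refine filter_congr fun w hw => ?_
    rw [Function.update_of_ne (G.ne_of_adj ((G.mem_neighborFinset v w).1 hw)).symm]
  have hrest : (∑ u ∈ univ.erase v, ∑ w ∈ univ.erase v,
      if G.Adj u w ∧ Function.update c v a u = Function.update c v a w then 1 else 0) =
      ∑ u ∈ univ.erase v, ∑ w ∈ univ.erase v, if G.Adj u w ∧ c u = c w then 1 else 0 := by
    refine sum_congr rfl fun u hu => sum_congr rfl fun w hw => ?_
    rw [Function.update_of_ne (ne_of_mem_erase hu), Function.update_of_ne (ne_of_mem_erase hw)]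
  rw [hsplit (Function.update c v a), hsplit c, hdeg, hrest]
  ring

end SimpleGraph

/-- For every integer `k > 0` and every finite simple graph `G`, for every `k`-list
assignment `L` of `G` there exists an `L`-colouring of `G` in which every vertex `v`
has at most `⌊deg(v)/k⌋` neighbours receiving the same colour as `v`. -/
theorem every_graph_has_list_colouring_with_degree_over_k_defect
    {V : Type*} [Fintype V] [DecidableEq V]
    (G : SimpleGraph V) [DecidableRel G.Adj]
    (k : ℕ) (hk : 0 < k)
    (L : V → Finset ℕ) (hL : ∀ v, k ≤ (L v).card) :
    ∃ c : V → ℕ, (∀ v, c v ∈ L v) ∧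
      ∀ v, ((G.neighborFinset v).filter (fun w => c w = c v)).card ≤ G.degree v / k := by
  have hne : (Fintype.piFinset L).Nonempty :=
    Fintype.piFinset_nonempty.2 fun v => Finset.card_pos.1 (hk.trans_le (hL v))
  obtain ⟨c, hc, hmin⟩ := (Fintype.piFinset L).exists_min_image G.monochromaticDarts hne
  rw [Fintype.mem_piFinset] at hc
  refine ⟨c, hc, fun v => ?_⟩
  obtain ⟨a, ha, hle⟩ := G.exists_colourDegree_le_degree_div hk c v (L v) (hL v)
  have hmem : Function.update c v a ∈ Fintype.piFinset L := by
    rw [Fintype.mem_piFinset]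
    intro u
    rcases eq_or_ne u v with rfl | hu
    · rwa [Function.update_self]
    · rw [Function.update_of_ne hu]
      exact hc u
  have hstep := G.monochromaticDarts_update_add c v a
  have hbest := hmin _ hmem
  change G.colourDegree c v (c v) ≤ _
  omega
end

section
/- For every integer t > 0, every finite simple graph G that is not (t,1)-choosable has at least 2t + 1 vertices. -/
/-- If `V` has at most `2 * t` elements and every list has at least `t` colours, then one can
choose from the lists so that every colour is chosen at most twice. -/
theorem exists_choice_of_card_le_two_mul {V α : Type*} [Fintype V] [DecidableEq α] {t : ℕ}
    (hV : Fintype.card V ≤ 2 * t) (L : V → Finset α) (hL : ∀ v, t ≤ (L v).card) :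
    ∃ c : V → α, (∀ v, c v ∈ L v) ∧
      ∀ u v w, c u = c v → c w = c v → u = v ∨ w = v ∨ u = w := by
  obtain ⟨f, hf, hfL⟩ := (Finset.all_card_le_biUnion_card_iff_exists_injective
    (fun v => L v ×ˢ (Finset.univ : Finset Bool))).1 <| by
      intro s
      obtain rfl | ⟨v, hv⟩ := s.eq_empty_or_nonempty
      · simp
      · have hsub := Finset.card_le_card (Finset.subset_biUnion_of_mem
          (fun v => L v ×ˢ (Finset.univ : Finset Bool)) hv)
        rw [Finset.card_product, Finset.card_univ, Fintype.card_bool] at hsub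
        have hs := s.card_le_univ
        have hv := hL v
        omega
  refine ⟨fun v => (f v).1, fun v => (Finset.mem_product.1 (hfL v)).1, fun u v w huv hwv => ?_⟩
  have hbool : (f u).2 = (f v).2 ∨ (f w).2 = (f v).2 ∨ (f u).2 = (f w).2 := by
    cases (f u).2 <;> cases (f v).2 <;> cases (f w).2 <;> simp
  exact hbool.imp (fun h => hf (Prod.ext huv h)) <|
    Or.imp (fun h => hf (Prod.ext hwv h)) (fun h => hf (Prod.ext (huv.trans hwv.symm) h))

/-- For every integer `t > 0`, every finite simple graph `G` that is not `(t,1)`-choosable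
has at least `2t + 1` vertices. -/
theorem not_choosable_defect_one_implies_many_vertices
    {V : Type*} [Fintype V] [DecidableEq V]
    (G : SimpleGraph V) [DecidableRel G.Adj]
    (t : ℕ) (ht : 0 < t)
    (hG : ¬ ∀ L : V → Finset ℕ, (∀ v, t ≤ (L v).card) →
      ∃ c : V → ℕ, (∀ v, c v ∈ L v) ∧
        ∀ v, ((G.neighborFinset v).filter (fun w => c w = c v)).card ≤ 1) :
    2 * t + 1 ≤ Fintype.card V := by
  contrapose! hG
  intro L hL
  obtain ⟨c, hcL, hc⟩ := exists_choice_of_card_le_two_mul (Nat.lt_succ_iff.1 hG) L hL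
  refine ⟨c, hcL, fun v => Finset.card_le_one.2 fun u hu w hw => ?_⟩
  simp only [Finset.mem_filter, SimpleGraph.mem_neighborFinset] at hu hw
  exact ((hc u v w hu.2 hw.2).resolve_left hu.1.ne').resolve_left hw.1.ne'
end
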